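/- arXiv:2204.11770 — 3 statements merged into one kernel-verified Lean document; each statement's English description precedes it below -/
import Mathlib

section
/- Let A be the companion matrix of f(x) = (x-1)^5 and B the companion matrix of g(x) = (x+1)(x⁴−x²+1), and set T = B·A⁻¹ in GL(5,ℚ). Then T² = I with T ≠ I, B has order 12 and no power of B equals −I, and the hypergeometric group Γ(f,g) = ⟨A,B⟩ is the free product of the subgroup generated by T and the subgroup generated by B: the canonical group homomorphism from the abstract free product (ℤ/2ℤ) ∗ (ℤ/12ℤ) to GL(5,ℚ) sending the generator of ℤ/2ℤ to T and the generator of ℤ/12ℤ to B is injective with image Γ(f,g). -/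
open Polynomial Matrix

/-- The companion matrix of a monic degree-5 rational polynomial `p`:
the `5 × 5` matrix whose entries in position `(i+1, i)` equal `1` for
`i = 1, ..., 4`, whose last column is `(-p₀, -p₁, -p₂, -p₃, -p₄)ᵀ`
(where `pᵢ` is the coefficient of `xⁱ` in `p`), and whose remaining
entries are `0`. -/
def companionMatrix (p : ℚ[X]) : Matrix (Fin 5) (Fin 5) ℚ :=
  Matrix.of fun i j : Fin 5 =>
    if (j : ℕ) = 4 then -p.coeff i
    else if (i : ℕ) = (j : ℕ) + 1 then 1 else 0

open Monoid in
/-- Every element of `ℤ/2 ∗ ℤ/n`, with generators `t` and `b`, has the form `bⁱ w tᵉ` where `w` is a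
product of factors `t bʲ` with `0 < j < n`. -/
theorem coprod_zmod_two_normal_form {n : ℕ} [NeZero n]
    (g : Coprod (Multiplicative (ZMod 2)) (Multiplicative (ZMod n))) :
    ∃ (i : ℕ) (L : List ℕ) (e : ℕ), i < n ∧ (∀ j ∈ L, 0 < j ∧ j < n) ∧ e < 2 ∧
      g = Coprod.inr (Multiplicative.ofAdd (1 : ZMod n)) ^ i *
        (L.map fun j => Coprod.inl (Multiplicative.ofAdd (1 : ZMod 2)) *
          Coprod.inr (Multiplicative.ofAdd (1 : ZMod n)) ^ j).prod *
        Coprod.inl (Multiplicative.ofAdd (1 : ZMod 2)) ^ e := by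
  have pow_val {k : ℕ} [NeZero k] (m : Multiplicative (ZMod k)) :
      m = Multiplicative.ofAdd (1 : ZMod k) ^ m.toAdd.val := by
    rw [← ofAdd_nsmul]; simp
  have pow_mod {k : ℕ} (i : ℕ) : Multiplicative.ofAdd (1 : ZMod k) ^ (i % k) =
      Multiplicative.ofAdd (1 : ZMod k) ^ i := by
    rw [← ofAdd_nsmul, ← ofAdd_nsmul]; simp
  have hn : 0 < n := NeZero.pos n
  induction g using Coprod.induction_on' with
  | one => exact ⟨0, [], 0, hn, by simp, by simp, by simp⟩
  | inl_mul m x ih =>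
    obtain ⟨i, L, e, hi, hL, he, rfl⟩ := ih
    have hm : m.toAdd.val = 0 ∨ m.toAdd.val = 1 := by
      have := ZMod.val_lt m.toAdd
      omega
    rw [pow_val m, map_pow]
    rcases hm with hm | hm <;> rw [hm]
    · exact ⟨i, L, e, hi, hL, he, by simp⟩
    rcases Nat.eq_zero_or_pos i with rfl | hi0
    · cases L with
      | nil =>
        refine ⟨0, [], (1 + e) % 2, hn, by simp, Nat.mod_lt _ two_pos, ?_⟩
        rw [← map_pow _ _ ((1 + e) % 2), pow_mod]
        simp [pow_add]
      | cons j L =>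
        obtain ⟨hj, hL⟩ := List.forall_mem_cons.1 hL
        refine ⟨j, L, e, hj.2, hL, he, ?_⟩
        have ht : (Coprod.inl (Multiplicative.ofAdd (1 : ZMod 2)) :
            Coprod _ (Multiplicative (ZMod n))) * Coprod.inl (Multiplicative.ofAdd 1) = 1 := by
          rw [← map_mul, ← ofAdd_add]
          exact map_one _
        simp only [List.map_cons, List.prod_cons, pow_zero, pow_one, one_mul, ← mul_assoc, ht]
    · exact ⟨0, i :: L, e, hn, List.forall_mem_cons.2 ⟨⟨hi0, hi⟩, hL⟩, he, by simp [mul_assoc]⟩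
  | inr_mul m x ih =>
    obtain ⟨i, L, e, hi, hL, he, rfl⟩ := ih
    refine ⟨(m.toAdd.val + i) % n, L, e, Nat.mod_lt _ hn, hL, he, ?_⟩
    rw [← map_pow _ _ ((m.toAdd.val + i) % n), pow_mod, pow_add, ← pow_val, map_mul, map_pow]
    simp only [mul_assoc]

open Monoid in
/-- A ping-pong criterion for `ℤ/2 ∗ ℤ/n`, with generators `t` and `b`: the maps `t bʲ`, `0 < j < n`,
send both `X` and the `t`-invariant set `Z` into `X`, and `X` and `Z` are disjoint. -/
theorem coprod_zmod_two_injective_of_ping_pong {n : ℕ} [NeZero n] {G α : Type*} [Group G]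
    [MulAction G α] (φ : Coprod (Multiplicative (ZMod 2)) (Multiplicative (ZMod n)) →* G) {t b : G}
    (ht : φ (Coprod.inl (Multiplicative.ofAdd (1 : ZMod 2))) = t)
    (hb : φ (Coprod.inr (Multiplicative.ofAdd (1 : ZMod n))) = b) (ht1 : t ≠ 1)
    {X Z : Set α} (hZ : Z.Nonempty) (hXZ : Disjoint X Z) (htZ : ∀ z ∈ Z, t • z ∈ Z)
    (hX : ∀ x ∈ X, ∀ j : ℕ, 0 < j → j < n → t • b ^ j • x ∈ X)
    (hZX : ∀ z ∈ Z, ∀ j : ℕ, 0 < j → j < n → t • b ^ j • z ∈ X) :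
    Function.Injective φ := by
  rw [injective_iff_map_eq_one]
  intro g hg
  obtain ⟨i, L, e, hi, hL, he, rfl⟩ := coprod_zmod_two_normal_form g
  simp only [map_mul, map_pow, map_list_prod, List.map_map, Function.comp_def, ht, hb] at hg
  have word_mem : ∀ L : List ℕ, (∀ j ∈ L, 0 < j ∧ j < n) → L ≠ [] → ∀ z ∈ Z,
      (L.map fun j => t * b ^ j).prod • z ∈ X := by
    intro L
    induction L with
    | nil => intro _ h; exact absurd rfl h
    | cons j L ih =>
      intro hL _ z hz
      obtain ⟨hj, hL⟩ := List.forall_mem_cons.1 hL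
      rw [List.map_cons, List.prod_cons, mul_smul, mul_smul]
      by_cases h : L = []
      · subst h
        simpa using hZX z hz j hj.1 hj.2
      · exact hX _ (ih hL h z hz) j hj.1 hj.2
  obtain ⟨z, hz⟩ := hZ
  have hz' : t ^ e • z ∈ Z := by
    interval_cases e
    · simpa using hz
    · simpa using htZ z hz
  have hgz : b ^ i • (L.map fun j => t * b ^ j).prod • t ^ e • z = z := by
    rw [← mul_smul, ← mul_smul, hg, one_smul]
  have hi0 : i = 0 := by
    by_contra h
    have hpos := Nat.pos_of_ne_zero h
    refine Set.disjoint_right.1 hXZ (htZ z hz) ?_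
    rw [← hgz]
    by_cases hL0 : L = []
    · subst hL0
      simpa [hgz] using hZX _ hz' i hpos hi
    · simpa [hgz] using hX _ (word_mem L hL hL0 _ hz') i hpos hi
  subst hi0
  by_cases hL0 : L = []
  · subst hL0
    interval_cases e
    · simp
    · exact absurd (by simpa using hg) ht1
  · refine absurd hz (Set.disjoint_left.1 hXZ ?_)
    rw [← hgz]
    simpa [hgz] using word_mem L hL hL0 _ hz'

theorem exists_monoidHom_zmod {G : Type*} [Group G] {n : ℕ} {g : G} (h : g ^ n = 1) :
    ∃ f : Multiplicative (ZMod n) →* G, f (Multiplicative.ofAdd 1) = g := by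
  have h' : zmultiplesHom _ (Additive.ofMul g) (n : ℤ) = 0 := by simp [← ofMul_pow, h]
  refine ⟨AddMonoidHom.toMultiplicativeLeft (ZMod.lift n ⟨_, h'⟩), ?_⟩
  have h1 := ZMod.lift_coe n ⟨_, h'⟩ 1
  rw [Int.cast_one] at h1
  simp [h1]

theorem companionMatrix_X_sub_one_pow_five : companionMatrix ((X - 1) ^ 5) =
    !![0, 0, 0, 0, 1; 1, 0, 0, 0, -5; 0, 1, 0, 0, 10; 0, 0, 1, 0, -10; 0, 0, 0, 1, 5] := by
  have h : ((X - 1) ^ 5 : ℚ[X]) =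
      X ^ 5 - C 5 * X ^ 4 + C 10 * X ^ 3 - C 10 * X ^ 2 + C 5 * X - C 1 := by
    simp only [map_ofNat, map_one]
    ring
  ext i j
  rw [companionMatrix, h]
  fin_cases i <;> fin_cases j <;> simp [coeff_X, coeff_one, coeff_X_pow]

theorem companionMatrix_X_add_one_mul : companionMatrix ((X + 1) * (X ^ 4 - X ^ 2 + 1)) =
    !![0, 0, 0, 0, -1; 1, 0, 0, 0, -1; 0, 1, 0, 0, 1; 0, 0, 1, 0, 1; 0, 0, 0, 1, -1] := by
  have h : ((X + 1) * (X ^ 4 - X ^ 2 + 1) : ℚ[X]) = X ^ 5 + X ^ 4 - X ^ 3 - X ^ 2 + X + 1 := by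
    ring
  ext i j
  rw [companionMatrix, h]
  fin_cases i <;> fin_cases j <;> simp [coeff_X, coeff_one, coeff_X_pow]

namespace HypergeometricPingPong

def matB : Matrix (Fin 5) (Fin 5) ℚ :=
  !![0, 0, 0, 0, -1; 1, 0, 0, 0, -1; 0, 1, 0, 0, 1; 0, 0, 1, 0, 1; 0, 0, 0, 1, -1]

def matT : Matrix (Fin 5) (Fin 5) ℚ :=
  !![-1, 0, 0, 0, 0; 4, 1, 0, 0, 0; -9, 0, 1, 0, 0; 11, 0, 0, 1, 0; -6, 0, 0, 0, 1]

/-- An open polyhedral cone sent into itself by the matrices `(-1)ʲ⁺¹ T Bʲ`, `0 < j < 12`. -/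
def cone : Set (Fin 5 → ℚ) :=
  {x | 0 < 2 * x 1 + x 2 - x 3 - 2 * x 4 ∧
    0 < 2 * x 0 - x 1 - 2 * x 2 - x 3 + 2 * x 4 ∧
    0 < -3 * x 0 - x 1 + x 2 + 3 * x 3 + 5 * x 4 ∧
    0 < x 0 + x 1 + x 2 + x 3 + x 4 ∧
    0 < 6 * x 0 - 2 * x 1 + x 2 + 2 * x 3 + x 4 ∧
    0 < -3 * x 0 - 5 * x 1 - 3 * x 2 - x 3 + x 4 ∧
    0 < x 0 - x 1 - x 2 - x 3 - x 4}

/-- The eigenvector of `T` for the eigenvalue `-1`. -/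
def reflectionVector : Fin 5 → ℚ := ![-2, 4, -9, 11, -6]

theorem exists_eq_vecCons (x : Fin 5 → ℚ) : ∃ a b c d e, x = ![a, b, c, d, e] :=
  ⟨x 0, x 1, x 2, x 3, x 4, by ext i; fin_cases i <;> rfl⟩

theorem matB_mulVec (a b c d e : ℚ) :
    matB *ᵥ ![a, b, c, d, e] = ![-e, a - e, b + e, c + e, d - e] := by
  ext i
  fin_cases i <;> simp [matB, mulVec, dotProduct, Fin.sum_univ_succ] <;> ring

theorem matT_mulVec (a b c d e : ℚ) :
    matT *ᵥ ![a, b, c, d, e] = ![-a, 4 * a + b, -9 * a + c, 11 * a + d, -6 * a + e] := by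
  ext i
  fin_cases i <;> simp [matT, mulVec, dotProduct, Fin.sum_univ_succ]

theorem matB_pow_mulVec_succ (j : ℕ) (x : Fin 5 → ℚ) :
    matB ^ (j + 1) *ᵥ x = matB ^ j *ᵥ (matB *ᵥ x) := by
  rw [pow_succ, mulVec_mulVec]

set_option maxHeartbeats 1600000 in
theorem neg_one_pow_smul_mulVec_mem_cone {x : Fin 5 → ℚ} (hx : x ∈ cone) {j : ℕ} (h0 : 0 < j)
    (h1 : j < 12) : (-1 : ℚ) ^ (j + 1) • (matT *ᵥ (matB ^ j *ᵥ x)) ∈ cone := by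
  obtain ⟨a, b, c, d, e, rfl⟩ := exists_eq_vecCons x
  simp only [cone, Set.mem_ofPred_eq, cons_val] at hx
  obtain ⟨h₀, h₁, h₂, h₃, h₄, h₅, h₆⟩ := hx
  interval_cases j <;>
    simp only [matB_pow_mulVec_succ, matB_mulVec, matT_mulVec, pow_zero, one_mulVec, cone,
      Set.mem_ofPred_eq, smul_cons, smul_eq_mul, cons_val, Nat.reduceAdd] <;>
    refine ⟨?_, ?_, ?_, ?_, ?_, ?_, ?_⟩ <;> linarith

set_option maxHeartbeats 1600000 in
theorem neg_one_pow_smul_mulVec_reflectionVector_mem_cone {j : ℕ} (h0 : 0 < j) (h1 : j < 12) :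
    (-1 : ℚ) ^ j • (matT *ᵥ (matB ^ j *ᵥ reflectionVector)) ∈ cone := by
  rw [reflectionVector]
  interval_cases j <;>
    simp only [matB_pow_mulVec_succ, matB_mulVec, matT_mulVec, pow_zero, one_mulVec, cone,
      Set.mem_ofPred_eq, smul_cons, smul_eq_mul, cons_val] <;>
    norm_num

/-- The union of `cone` and its negative. -/
def doubleCone : Set (Fin 5 → ℚ) := {x | x ∈ cone ∨ -x ∈ cone}

theorem mem_doubleCone_of_neg_one_pow_smul {x : Fin 5 → ℚ} {k : ℕ}
    (h : (-1 : ℚ) ^ k • x ∈ cone) : x ∈ doubleCone := by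
  rcases neg_one_pow_eq_or ℚ k with hk | hk <;> rw [hk] at h
  · exact Or.inl (by simpa using h)
  · exact Or.inr (by simpa using h)

theorem neg_mem_doubleCone {x : Fin 5 → ℚ} : -x ∈ doubleCone ↔ x ∈ doubleCone := by
  simp [doubleCone, or_comm]

theorem mulVec_mem_doubleCone {x : Fin 5 → ℚ} (hx : x ∈ doubleCone) {j : ℕ} (h0 : 0 < j)
    (h1 : j < 12) : matT *ᵥ (matB ^ j *ᵥ x) ∈ doubleCone := by
  rcases hx with hx | hx
  · exact mem_doubleCone_of_neg_one_pow_smul (neg_one_pow_smul_mulVec_mem_cone hx h0 h1)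
  · rw [← neg_mem_doubleCone, ← mulVec_neg, ← mulVec_neg]
    exact mem_doubleCone_of_neg_one_pow_smul (neg_one_pow_smul_mulVec_mem_cone hx h0 h1)

theorem mulVec_reflectionVector_mem_doubleCone {j : ℕ} (h0 : 0 < j) (h1 : j < 12) :
    matT *ᵥ (matB ^ j *ᵥ reflectionVector) ∈ doubleCone :=
  mem_doubleCone_of_neg_one_pow_smul (neg_one_pow_smul_mulVec_reflectionVector_mem_cone h0 h1)

theorem reflectionVector_notMem_doubleCone : reflectionVector ∉ doubleCone := by
  simp only [doubleCone, cone, reflectionVector, Set.mem_ofPred_eq, Pi.neg_apply, cons_val]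
  norm_num

theorem matT_mulVec_reflectionVector : matT *ᵥ reflectionVector = -reflectionVector := by
  rw [reflectionVector, matT_mulVec]
  norm_num

theorem matT_sq : matT ^ 2 = 1 := by
  ext i j
  fin_cases i <;> fin_cases j <;> simp [matT, sq, mul_apply, Fin.sum_univ_succ]

theorem matB_pow_twelve : matB ^ 12 = 1 := by
  refine mulVec_injective (funext fun x => ?_)
  obtain ⟨a, b, c, d, e, rfl⟩ := exists_eq_vecCons x
  simp only [matB_pow_mulVec_succ, matB_mulVec, pow_zero, one_mulVec]
  ext i
  fin_cases i <;> simp only [cons_val, Fin.reduceFinMk] <;> ring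

theorem matT_mul_companionMatrix : matT * companionMatrix ((X - 1) ^ 5) = matB := by
  rw [companionMatrix_X_sub_one_pow_five]
  ext i j
  fin_cases i <;> fin_cases j <;> norm_num [matT, matB, mul_apply, Fin.sum_univ_succ]

end HypergeometricPingPong

open HypergeometricPingPong

/-- `Γ(f,g) = ⟨T⟩ ∗ ⟨B⟩` for `f = ((X - 1) ^ 5)`, `g = ((X + 1) * (X ^ 4 - X ^ 2 + 1))`. -/
theorem hypergeometric_free_product_case8 (A B T : GL (Fin 5) ℚ)
    (hA : (↑A : Matrix (Fin 5) (Fin 5) ℚ) = companionMatrix ((X - 1) ^ 5))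
    (hB : (↑B : Matrix (Fin 5) (Fin 5) ℚ) = companionMatrix ((X + 1) * (X ^ 4 - X ^ 2 + 1)))
    (hT : T = B * A⁻¹) :
    T ^ 2 = 1 ∧ T ≠ 1 ∧ orderOf B = 12 ∧ (∀ i : ℤ, B ^ i ≠ -1) ∧
    ∃ φ : Monoid.Coprod (Multiplicative (ZMod 2)) (Multiplicative (ZMod 12)) →* GL (Fin 5) ℚ,
      φ (Monoid.Coprod.inl (Multiplicative.ofAdd (1 : ZMod 2))) = T ∧
      φ (Monoid.Coprod.inr (Multiplicative.ofAdd (1 : ZMod 12))) = B ∧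
      Function.Injective φ ∧
      φ.range = Subgroup.closure {A, B} := by
  have hA' : T * A = B := by rw [hT, inv_mul_cancel_right]
  have hBm : (B : Matrix (Fin 5) (Fin 5) ℚ) = matB := hB.trans companionMatrix_X_add_one_mul
  have hTm : (T : Matrix (Fin 5) (Fin 5) ℚ) = matT := by
    refine (Units.mul_left_inj A).1 ?_
    rw [← Units.val_mul, hA', hBm, hA, matT_mul_companionMatrix]
  let _ : MulAction (GL (Fin 5) ℚ) (Fin 5 → ℚ) :=
    { smul := fun g x => g.val *ᵥ x
      one_smul := fun x => one_mulVec x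
      mul_smul := fun g h x => (mulVec_mulVec x g.val h.val).symm }
  have smul_def (g : GL (Fin 5) ℚ) (x : Fin 5 → ℚ) : g • x = g.val *ᵥ x := rfl
  have smul_word (j : ℕ) (x : Fin 5 → ℚ) : T • B ^ j • x = matT *ᵥ (matB ^ j *ᵥ x) := by
    rw [smul_def, smul_def, Units.val_pow_eq_pow_val, hTm, hBm]
  have hT2 : T ^ 2 = 1 := Units.ext (by rw [Units.val_pow_eq_pow_val, hTm, matT_sq, Units.val_one])
  have hB12 : B ^ 12 = 1 :=
    Units.ext (by rw [Units.val_pow_eq_pow_val, hBm, matB_pow_twelve, Units.val_one])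
  have hTv : T • reflectionVector = -reflectionVector := by
    rw [smul_def, hTm, matT_mulVec_reflectionVector]
  have hv : reflectionVector ≠ -reflectionVector := fun h => by
    have := congrFun h 0
    norm_num [reflectionVector] at this
  have hT1 : T ≠ 1 := by
    rintro rfl
    exact hv (by rw [← hTv, one_smul])
  obtain ⟨f, hf⟩ := exists_monoidHom_zmod hT2
  obtain ⟨f', hf'⟩ := exists_monoidHom_zmod hB12
  have hinj : Function.Injective (Monoid.Coprod.lift f f') := by
    refine coprod_zmod_two_injective_of_ping_pong (Monoid.Coprod.lift f f') (t := T) (b := B)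
      (by simpa using hf) (by simpa using hf') hT1 (X := doubleCone)
      (Z := {reflectionVector, -reflectionVector}) (Set.insert_nonempty _ _) ?_ ?_ ?_ ?_
    · rw [Set.disjoint_right]
      rintro z (rfl | rfl)
      · exact reflectionVector_notMem_doubleCone
      · exact fun h => reflectionVector_notMem_doubleCone (neg_mem_doubleCone.1 h)
    · rintro z (rfl | rfl)
      · exact Or.inr hTv
      · exact Or.inl (by rw [smul_def, mulVec_neg, ← smul_def, hTv, neg_neg])
    · intro x hx j h0 h1
      rw [smul_word]
      exact mulVec_mem_doubleCone hx h0 h1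
    · rintro z (rfl | rfl) j h0 h1 <;> rw [smul_word]
      · exact mulVec_reflectionVector_mem_doubleCone h0 h1
      · rw [mulVec_neg, mulVec_neg, neg_mem_doubleCone]
        exact mulVec_reflectionVector_mem_doubleCone h0 h1
  have horder : orderOf B = 12 := by
    have h := orderOf_injective (Monoid.Coprod.lift f f') hinj
      (Monoid.Coprod.inr (Multiplicative.ofAdd (1 : ZMod 12)))
    rw [Monoid.Coprod.lift_apply_inr, hf', orderOf_injective _ Monoid.Coprod.inr_injective,
      orderOf_ofAdd_eq_addOrderOf, ZMod.addOrderOf_one] at h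
    exact h
  refine ⟨hT2, hT1, horder, fun i hi => ?_, Monoid.Coprod.lift f f', by simpa using hf,
    by simpa using hf', hinj, ?_⟩
  · obtain ⟨j, hj, hij⟩ : ∃ j : ℕ, j < 12 ∧ B ^ j = B ^ i := by
      refine ⟨(i % 12).toNat, by omega, ?_⟩
      rw [← zpow_natCast, Int.toNat_of_nonneg (by omega), ← zpow_mod_orderOf B i, horder]
      rfl
    have hBv : B ^ j • reflectionVector = -reflectionVector := by
      rw [hij, hi, smul_def, Units.val_neg, Units.val_one, neg_mulVec, one_mulVec]
    rcases Nat.eq_zero_or_pos j with rfl | h0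
    · exact hv (by rw [← hBv, pow_zero, one_smul])
    · refine reflectionVector_notMem_doubleCone ?_
      have h := mulVec_reflectionVector_mem_doubleCone h0 hj
      rwa [← smul_word, hBv, smul_def, mulVec_neg, ← smul_def, hTv, neg_neg] at h
  · have range_eq {n : ℕ} {g : GL (Fin 5) ℚ} (k : Multiplicative (ZMod n) →* GL (Fin 5) ℚ)
        (hk : k (Multiplicative.ofAdd 1) = g) : k.range = Subgroup.zpowers g := by
      refine le_antisymm ?_ (by rw [Subgroup.zpowers_le]; exact ⟨_, hk⟩)
      rintro _ ⟨x, rfl⟩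
      refine ⟨(x.toAdd.cast : ℤ), ?_⟩
      simp only [← hk, ← map_zpow, ← ofAdd_zsmul]
      simp
    rw [Monoid.Coprod.range_lift, range_eq f hf, range_eq f' hf']
    refine le_antisymm ?_ ?_
    · have hAm : A ∈ Subgroup.closure {A, B} := Subgroup.subset_closure (Or.inl rfl)
      have hBm : B ∈ Subgroup.closure {A, B} := Subgroup.subset_closure (Or.inr rfl)
      rw [sup_le_iff, Subgroup.zpowers_le, Subgroup.zpowers_le, hT]
      exact ⟨mul_mem hBm (inv_mem hAm), hBm⟩
    · have hTm : T ∈ Subgroup.zpowers T ⊔ Subgroup.zpowers B :=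
        Subgroup.mem_sup_left (Subgroup.mem_zpowers T)
      have hBm : B ∈ Subgroup.zpowers T ⊔ Subgroup.zpowers B :=
        Subgroup.mem_sup_right (Subgroup.mem_zpowers B)
      rw [Subgroup.closure_le]
      rintro x (rfl | rfl)
      · rw [← inv_mul_eq_iff_eq_mul.2 hA'.symm]
        exact mul_mem (inv_mem hTm) hBm
      · exact hBm
end

section
/- Let A be the companion matrix of f(x) = (x-1)³(x²+1) and B the companion matrix of g(x) = (x+1)³(x²+x+1), and set T = B·A⁻¹ in GL(5,ℚ). Then T² = I with T ≠ I, B has infinite order, and the hypergeometric group Γ(f,g) = ⟨A,B⟩ is the free product of the subgroup generated by T and the subgroup generated by B: the canonical group homomorphism from the abstract free product (ℤ/2ℤ) ∗ ℤ to GL(5,ℚ) sending the generator of ℤ/2ℤ to T and the generator of ℤ to B is injective with image Γ(f,g). -/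
open Polynomial Matrix

universe u
abbrev BinaryFactor (M N : Type u) : Bool → Type u
  | false => M
  | true => N

instance (M N : Type u) [Group M] [Group N] : ∀ i, Group (BinaryFactor M N i)
  | false => inferInstanceAs (Group M)
  | true => inferInstanceAs (Group N)

/-- The ping-pong lemma for two factors, the second of which has at least three elements. -/
theorem Monoid.Coprod.lift_injective_of_ping_pong {M N : Type u} {G α : Type*} [Group M] [Group N]
    [Group G] [MulAction G α] (f : M →* G) (g : N →* G) (hN : 3 ≤ Cardinal.mk N) (X Y : Set α)
    (hX : X.Nonempty) (hY : Y.Nonempty) (hXY : Disjoint X Y)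
    (hf : ∀ m ≠ 1, ∀ y ∈ Y, f m • y ∈ X) (hg : ∀ n ≠ 1, ∀ x ∈ X, g n • x ∈ Y) :
    Function.Injective (Monoid.Coprod.lift f g) := by
  let F : ∀ i, BinaryFactor M N i →* G := fun
    | false => f
    | true => g
  have hF : Function.Injective (Monoid.CoprodI.lift F) := by
    refine Monoid.CoprodI.lift_injective_of_ping_pong F (.inr ⟨true, hN⟩)
      (fun i => cond i Y X) ?_ ?_ ?_
    · rintro (_ | _) <;> assumption
    · rintro (_ | _) (_ | _) h
      exacts [absurd rfl h, hXY, hXY.symm, absurd rfl h]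
    · rintro (_ | _) (_ | _) h
      · exact absurd rfl h
      · rintro m hm _ ⟨y, hy, rfl⟩
        exact hf m hm y hy
      · rintro n hn _ ⟨x, hx, rfl⟩
        exact hg n hn x hx
      · exact absurd rfl h
  let toI : Monoid.Coprod M N →* Monoid.CoprodI (BinaryFactor M N) :=
    Monoid.Coprod.lift (Monoid.CoprodI.of (M := BinaryFactor M N) (i := false))
      (Monoid.CoprodI.of (M := BinaryFactor M N) (i := true))
  let ofI : Monoid.CoprodI (BinaryFactor M N) →* Monoid.Coprod M N :=
    Monoid.CoprodI.lift fun
      | false => Monoid.Coprod.inl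
      | true => Monoid.Coprod.inr
  have hinv : ofI.comp toI = MonoidHom.id _ := by
    apply Monoid.Coprod.hom_ext <;> ext <;> simp [toI, ofI]
  have hcomp : (Monoid.CoprodI.lift F).comp toI = Monoid.Coprod.lift f g := by
    apply Monoid.Coprod.hom_ext <;> ext <;> simp [toI, F]
  rw [← hcomp, MonoidHom.coe_comp]
  exact hF.comp (Function.LeftInverse.injective (g := ofI) (DFunLike.congr_fun hinv))

/-- The homomorphism from the cyclic group of order two determined by an involution. -/
def involutionHom {G : Type*} [Group G] (t : G) (ht : t * t = 1) : Multiplicative (ZMod 2) →* G where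
  toFun z := t ^ z.toAdd.val
  map_one' := pow_zero t
  map_mul' a b := by
    have h01 : ∀ z : Multiplicative (ZMod 2), z = 1 ∨ z = Multiplicative.ofAdd 1 := by decide
    rw [← pow_add]
    rcases h01 a with rfl | rfl <;> rcases h01 b with rfl | rfl
    · rfl
    · rfl
    · rfl
    · change t ^ 0 = t ^ 2
      rw [pow_zero, pow_two, ht]

@[simp]
theorem involutionHom_ofAdd_one {G : Type*} [Group G] (t : G) (ht : t * t = 1) :
    involutionHom t ht (Multiplicative.ofAdd 1) = t :=
  pow_one t

/-- Ping-pong for an involution `t` and an element `b` that is inverted by an involution `j`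
commuting with `t`: a set `S` that contains `b • S`, `b • t • S` and `b • t • j • S`,
and that is disjoint from `t • S` and `j • t • S`, certifies that `t` and `b` generate `ℤ/2 * ℤ`. -/
theorem lift_injective_of_reversible {G α : Type*} [Group G] [MulAction G α] {t b j : G}
    (ht : t * t = 1) (hj : j * j = 1) (hjt : j * t = t * j) (hjb : j * b⁻¹ = b * j)
    (S : Set α) (hS : S.Nonempty) (hb : ∀ x ∈ S, b • x ∈ S) (hbt : ∀ x ∈ S, b • t • x ∈ S)
    (hbtj : ∀ x ∈ S, b • t • j • x ∈ S) (htS : ∀ x ∈ S, t • x ∉ S)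
    (hjtS : ∀ x ∈ S, j • t • x ∉ S) :
    Function.Injective (Monoid.Coprod.lift (involutionHom t ht) (zpowersHom G b)) := by
  have htt (x : α) : t • t • x = x := by rw [smul_smul, ht, one_smul]
  have hjj (x : α) : j • j • x = x := by rw [smul_smul, hj, one_smul]
  have hcomm (x : α) : j • t • x = t • j • x := by rw [smul_smul, hjt, mul_smul]
  have hinv (x : α) : j • b⁻¹ • x = b • j • x := by rw [smul_smul, hjb, mul_smul]
  have hpos : ∀ n : ℕ, ∀ x, x ∈ S ∨ j • x ∈ S → b ^ (n + 1) • t • x ∈ S := by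
    intro n
    induction n with
    | zero =>
      rintro x (hx | hx)
      · simpa using hbt x hx
      · simpa [hjj] using hbtj _ hx
    | succ n ih =>
      intro x hx
      rw [pow_succ', mul_smul]
      exact hb _ (ih x hx)
  have hconj (n : ℕ) (x : α) : j • b⁻¹ ^ n • x = b ^ n • j • x := by
    induction n generalizing x with
    | zero => simp
    | succ n ih => rw [pow_succ, mul_smul, ih, hinv, smul_smul, ← pow_succ]
  have hneg (n : ℕ) (x : α) (hx : x ∈ S ∨ j • x ∈ S) : j • b⁻¹ ^ (n + 1) • t • x ∈ S := by
    rw [hconj, hcomm]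
    exact hpos n _ (by rw [hjj]; exact hx.symm)
  refine Monoid.Coprod.lift_injective_of_ping_pong _ _ ?_ {y | t • y ∈ S ∨ j • t • y ∈ S}
    {x | x ∈ S ∨ j • x ∈ S} ?_ ?_ ?_ ?_ ?_
  · exact (Cardinal.natCast_lt_aleph0 (n := 3)).le.trans (Cardinal.aleph0_le_mk _)
  · obtain ⟨x, hx⟩ := hS
    exact ⟨t • x, .inl (by rwa [htt])⟩
  · obtain ⟨x, hx⟩ := hS
    exact ⟨x, .inl hx⟩
  · rw [Set.disjoint_left]
    rintro y (hy | hy) (hmem | hmem)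
    · exact htS y hmem hy
    · exact hjtS _ hmem (by rwa [← hcomm, hjj])
    · exact hjtS y hmem hy
    · exact htS _ hmem (by rwa [← hcomm])
  · intro m hm x hx
    obtain rfl : m = Multiplicative.ofAdd 1 := by
      revert m; decide
    simpa [htt] using hx
  · intro n hn y hy
    have hmem : t • y ∈ S ∨ j • t • y ∈ S := hy
    rw [zpowersHom_apply, ← htt y]
    obtain ⟨k, hk⟩ := Int.eq_nat_or_neg n.toAdd
    obtain _ | k := k
    · exact absurd (by simpa using hk) hn
    rcases hk with hk | hk
    · left
      rw [hk, zpow_natCast]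
      exact hpos k _ hmem
    · right
      rw [hk, _root_.zpow_neg, zpow_natCast, ← inv_pow]
      exact hneg k _ hmem

/-- The matrix of `B`. -/
def matB : Matrix (Fin 5) (Fin 5) ℚ :=
  !![0, 0, 0, 0, -1; 1, 0, 0, 0, -4; 0, 1, 0, 0, -7; 0, 0, 1, 0, -7; 0, 0, 0, 1, -4]

/-- The matrix of the reflection `T`. -/
def matT : Matrix (Fin 5) (Fin 5) ℚ :=
  !![-1, 0, 0, 0, 0; -1, 1, 0, 0, 0; -11, 0, 1, 0, 0; -3, 0, 0, 1, 0; -7, 0, 0, 0, 1]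

/-- An involution that commutes with `T` and conjugates `B` to its inverse. -/
def matJ : Matrix (Fin 5) (Fin 5) ℚ :=
  !![1, 0, 0, 0, 0; 4, 0, 0, 0, -1; 7, 0, 0, -1, 0; 7, 0, -1, 0, 0; 4, -1, 0, 0, 0]

/-- An open polyhedral cone mapped into itself by `-B`, `B * T` and `B * T * J`. -/
def pingPongCone : Set (Fin 5 → ℚ) :=
  {x | 0 < x 0 + x 1 - x 2 - x 3 + 3 * x 4 ∧ 0 < 31 * x 0 - x 2 - 2 * x 3 - 2 * x 4 ∧
    0 < 3 * x 0 - x 1 - x 2 + x 3 + x 4 ∧ 0 < 23 * x 0 - x 1 - x 2 - x 3 - x 4 ∧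
    0 < -3 * x 0 + x 1 ∧ 0 < 6 * x 0 - x 4 ∧
    0 < 17 * x 0 - x 3 - 2 * x 4 ∧ 0 < -x 0 + x 1 + x 2 - 3 * x 3 + 3 * x 4 ∧
    0 < x 0 + x 1 + x 2 - x 3 - x 4 ∧ 0 < 3 * x 0 - 3 * x 1 + x 2 + x 3 - x 4 ∧
    0 < -x 0 - x 1 + 3 * x 2 - 3 * x 3 + x 4 ∧ 0 < x 0 - 3 * x 1 + 3 * x 2 - x 3 - x 4}

theorem companionMatrix_f :
    companionMatrix ((X - 1) ^ 3 * (X ^ 2 + 1)) =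
      !![0, 0, 0, 0, 1; 1, 0, 0, 0, -3; 0, 1, 0, 0, 4; 0, 0, 1, 0, -4; 0, 0, 0, 1, 3] := by
  have h : ((X - 1) ^ 3 * (X ^ 2 + 1) : ℚ[X]) =
      X ^ 5 + C (-3) * X ^ 4 + C 4 * X ^ 3 + C (-4) * X ^ 2 + C 3 * X + C (-1) := by
    simp only [map_neg, map_ofNat, map_one]
    ring
  rw [h]
  ext i j
  fin_cases i <;> fin_cases j <;>
    simp [companionMatrix, coeff_X, coeff_X_pow, coeff_C, -map_neg]

theorem companionMatrix_g :
    companionMatrix ((X + 1) ^ 3 * (X ^ 2 + X + 1)) = matB := by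
  have h : ((X + 1) ^ 3 * (X ^ 2 + X + 1) : ℚ[X]) =
      X ^ 5 + C 4 * X ^ 4 + C 7 * X ^ 3 + C 7 * X ^ 2 + C 4 * X + C 1 := by
    simp only [map_ofNat, map_one]
    ring
  rw [h]
  ext i j
  fin_cases i <;> fin_cases j <;>
    simp [companionMatrix, matB, coeff_X, coeff_one, coeff_X_pow]

theorem matB_mulVec (x : Fin 5 → ℚ) :
    matB *ᵥ x = ![-x 4, x 0 - 4 * x 4, x 1 - 7 * x 4, x 2 - 7 * x 4, x 3 - 4 * x 4] := by
  ext i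
  fin_cases i <;> simp [matB, mulVec, dotProduct, Fin.sum_univ_succ] <;> ring

theorem matT_mulVec (x : Fin 5 → ℚ) :
    matT *ᵥ x = ![-x 0, x 1 - x 0, x 2 - 11 * x 0, x 3 - 3 * x 0, x 4 - 7 * x 0] := by
  ext i
  fin_cases i <;> simp [matT, mulVec, dotProduct, Fin.sum_univ_succ] <;> ring

theorem matJ_mulVec (x : Fin 5 → ℚ) :
    matJ *ᵥ x = ![x 0, 4 * x 0 - x 4, 7 * x 0 - x 3, 7 * x 0 - x 2, 4 * x 0 - x 1] := by
  ext i
  fin_cases i <;> simp [matJ, mulVec, dotProduct, Fin.sum_univ_succ] <;> ring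

theorem neg_matB_mulVec_mem {x : Fin 5 → ℚ} (hx : x ∈ pingPongCone) :
    -(matB *ᵥ x) ∈ pingPongCone := by
  simp only [pingPongCone, Set.mem_ofPred_eq] at hx
  obtain ⟨h1, h2, h3, h4, h5, h6, h7, h8, h9, h10, h11, h12⟩ := hx
  rw [matB_mulVec]
  refine ⟨?_, ?_, ?_, ?_, ?_, ?_, ?_, ?_, ?_, ?_, ?_, ?_⟩ <;> simp <;> linarith

theorem matB_matT_mulVec_mem {x : Fin 5 → ℚ} (hx : x ∈ pingPongCone) :
    matB *ᵥ matT *ᵥ x ∈ pingPongCone := by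
  simp only [pingPongCone, Set.mem_ofPred_eq] at hx
  obtain ⟨h1, h2, h3, h4, h5, h6, h7, h8, h9, h10, h11, h12⟩ := hx
  rw [matT_mulVec, matB_mulVec]
  refine ⟨?_, ?_, ?_, ?_, ?_, ?_, ?_, ?_, ?_, ?_, ?_, ?_⟩ <;> simp <;> linarith

theorem matB_matT_matJ_mulVec_mem {x : Fin 5 → ℚ} (hx : x ∈ pingPongCone) :
    matB *ᵥ matT *ᵥ matJ *ᵥ x ∈ pingPongCone := by
  simp only [pingPongCone, Set.mem_ofPred_eq] at hx
  obtain ⟨h1, h2, h3, h4, h5, h6, h7, h8, h9, h10, h11, h12⟩ := hx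
  rw [matJ_mulVec, matT_mulVec, matB_mulVec]
  refine ⟨?_, ?_, ?_, ?_, ?_, ?_, ?_, ?_, ?_, ?_, ?_, ?_⟩ <;> simp <;> linarith

theorem pingPongCone_nonempty : pingPongCone.Nonempty := by
  refine ⟨![102, 349, 789, 698, 464], ?_⟩
  unfold pingPongCone
  decide +kernel

theorem pos_of_mem_pingPongCone {x : Fin 5 → ℚ} (hx : x ∈ pingPongCone) : 0 < x 0 := by
  simp only [pingPongCone, Set.mem_ofPred_eq] at hx
  obtain ⟨h1, h2, h3, h4, h5, h6, h7, h8, h9, h10, h11, h12⟩ := hx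
  linarith

theorem matT_mulVec_notMem {x : Fin 5 → ℚ} (hx : x ∈ pingPongCone) :
    matT *ᵥ x ∉ pingPongCone ∧ matJ *ᵥ matT *ᵥ x ∉ pingPongCone := by
  have h0 := pos_of_mem_pingPongCone hx
  constructor <;> intro h <;> have h1 := pos_of_mem_pingPongCone h <;>
    simp [matT_mulVec, matJ_mulVec] at h1 <;> linarith

theorem neg_matT_mulVec_notMem {x : Fin 5 → ℚ} (hx : x ∈ pingPongCone) :
    -(matT *ᵥ x) ∉ pingPongCone := by
  intro h
  rw [matT_mulVec] at h
  simp [pingPongCone] at hx h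
  obtain ⟨h1, h2, h3, h4, h5, h6, h7, h8, h9, h10, h11, h12⟩ := hx
  obtain ⟨k1, k2, k3, k4, k5, k6, k7, k8, k9, k10, k11, k12⟩ := h
  linarith

theorem neg_matJ_matT_mulVec_notMem {x : Fin 5 → ℚ} (hx : x ∈ pingPongCone) :
    -(matJ *ᵥ matT *ᵥ x) ∉ pingPongCone := by
  intro h
  rw [matT_mulVec, matJ_mulVec] at h
  simp [pingPongCone] at hx h
  obtain ⟨h1, h2, h3, h4, h5, h6, h7, h8, h9, h10, h11, h12⟩ := hx
  obtain ⟨k1, k2, k3, k4, k5, k6, k7, k8, k9, k10, k11, k12⟩ := h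
  linarith

/-- `Γ(f,g) = ⟨T⟩ ∗ ⟨B⟩` for `f = ((X - 1) ^ 3 * (X ^ 2 + 1))`, `g = ((X + 1) ^ 3 * (X ^ 2 + X + 1))`. -/
theorem hypergeometric_free_product_case9 (A B T : GL (Fin 5) ℚ)
    (hA : (↑A : Matrix (Fin 5) (Fin 5) ℚ) = companionMatrix ((X - 1) ^ 3 * (X ^ 2 + 1)))
    (hB : (↑B : Matrix (Fin 5) (Fin 5) ℚ) = companionMatrix ((X + 1) ^ 3 * (X ^ 2 + X + 1)))
    (hT : T = B * A⁻¹) :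
    T ^ 2 = 1 ∧ T ≠ 1 ∧ ¬ IsOfFinOrder B ∧
    ∃ φ : Monoid.Coprod (Multiplicative (ZMod 2)) (Multiplicative ℤ) →* GL (Fin 5) ℚ,
      φ (Monoid.Coprod.inl (Multiplicative.ofAdd (1 : ZMod 2))) = T ∧
      φ (Monoid.Coprod.inr (Multiplicative.ofAdd (1 : ℤ))) = B ∧
      Function.Injective φ ∧
      φ.range = Subgroup.closure {A, B} := by
  rw [companionMatrix_f] at hA
  rw [companionMatrix_g] at hB
  have matT_sq : matT * matT = 1 := by decide +kernel
  have matJ_sq : matJ * matJ = 1 := by decide +kernel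
  let T₀ : GL (Fin 5) ℚ := ⟨matT, matT, matT_sq, matT_sq⟩
  let J : GL (Fin 5) ℚ := ⟨matJ, matJ, matJ_sq, matJ_sq⟩
  have hTA : T₀ * A = B := by
    ext1
    rw [Units.val_mul, hA, hB]
    exact (by decide +kernel : matT *
      !![0, 0, 0, 0, 1; 1, 0, 0, 0, -3; 0, 1, 0, 0, 4; 0, 0, 1, 0, -4; 0, 0, 0, 1, 3] = matB)
  obtain rfl : T = T₀ := by rw [hT, ← hTA, mul_inv_cancel_right]
  have hTT : T₀ * T₀ = 1 := Units.ext matT_sq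
  have hJJ : J * J = 1 := Units.ext matJ_sq
  have hJT : J * T₀ = T₀ * J := Units.ext (by decide +kernel : matJ * matT = matT * matJ)
  have hJB : J * B⁻¹ = B * J := by
    rw [mul_inv_eq_iff_eq_mul]
    ext1
    rw [Units.val_mul, Units.val_mul, hB]
    exact (by decide +kernel : matJ = matB * matJ * matB)
  let _ : MulAction (GL (Fin 5) ℚ) (Fin 5 → ℚ) :=
    { smul g x := (g : Matrix (Fin 5) (Fin 5) ℚ) *ᵥ x
      one_smul := one_mulVec
      mul_smul g h x := (mulVec_mulVec x g.val h.val).symm }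
  have hBx (x : Fin 5 → ℚ) : B • x = matB *ᵥ x := congrArg (· *ᵥ x) hB
  have hTx (x : Fin 5 → ℚ) : T₀ • x = matT *ᵥ x := rfl
  have hJx (x : Fin 5 → ℚ) : J • x = matJ *ᵥ x := rfl
  have hinj := lift_injective_of_reversible hTT hJJ hJT hJB
    {x | x ∈ pingPongCone ∨ -x ∈ pingPongCone}
    (pingPongCone_nonempty.mono fun _ => .inl)
    (by
      rintro x (hx | hx)
      · exact .inr (hBx x ▸ neg_matB_mulVec_mem hx)
      · exact .inl (by simpa [hBx, mulVec_neg] using neg_matB_mulVec_mem hx))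
    (by
      rintro x (hx | hx)
      · exact .inl (by simpa only [hBx, hTx] using matB_matT_mulVec_mem hx)
      · exact .inr (by simpa only [hBx, hTx, mulVec_neg] using matB_matT_mulVec_mem hx))
    (by
      rintro x (hx | hx)
      · exact .inl (by simpa only [hBx, hTx, hJx] using matB_matT_matJ_mulVec_mem hx)
      · exact .inr (by
          simpa only [hBx, hTx, hJx, mulVec_neg] using matB_matT_matJ_mulVec_mem hx))
    (by
      rintro x (hx | hx) (h | h) <;> rw [hTx] at h
      · exact (matT_mulVec_notMem hx).1 h
      · exact neg_matT_mulVec_notMem hx h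
      · exact neg_matT_mulVec_notMem hx (by rwa [mulVec_neg, neg_neg])
      · exact (matT_mulVec_notMem hx).1 (by rwa [mulVec_neg]))
    (by
      rintro x (hx | hx) (h | h) <;> rw [hTx, hJx] at h
      · exact (matT_mulVec_notMem hx).2 h
      · exact neg_matJ_matT_mulVec_notMem hx h
      · exact neg_matJ_matT_mulVec_notMem hx (by rwa [mulVec_neg, mulVec_neg, neg_neg])
      · exact (matT_mulVec_notMem hx).2 (by rwa [mulVec_neg, mulVec_neg]))
  have hl : Monoid.Coprod.lift (involutionHom T₀ hTT) (zpowersHom _ B)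
      (Monoid.Coprod.inl (Multiplicative.ofAdd (1 : ZMod 2))) = T₀ := by simp
  have hr : Monoid.Coprod.lift (involutionHom T₀ hTT) (zpowersHom _ B)
      (Monoid.Coprod.inr (Multiplicative.ofAdd (1 : ℤ))) = B := by simp
  refine ⟨by rw [pow_two, hTT], ?_, ?_, _, hl, hr, hinj, ?_⟩
  · rw [← hl, ← map_one (Monoid.Coprod.lift (involutionHom T₀ hTT) (zpowersHom _ B)), hinj.ne_iff,
      ← map_one Monoid.Coprod.inl, Monoid.Coprod.inl_injective.ne_iff]
    decide
  · rw [← hr, hinj.isOfFinOrder_iff, Monoid.Coprod.inr_injective.isOfFinOrder_iff,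
      isOfFinOrder_ofAdd_iff]
    exact not_isOfFinAddOrder_of_isAddTorsionFree one_ne_zero
  · apply le_antisymm
    · have hBmem : B ∈ Subgroup.closure {A, B} := Subgroup.subset_closure (by simp)
      have hAmem : A ∈ Subgroup.closure {A, B} := Subgroup.subset_closure (by simp)
      rw [Monoid.Coprod.range_lift, sup_le_iff]
      constructor
      · rintro _ ⟨z, rfl⟩
        exact pow_mem (hT ▸ mul_mem hBmem (inv_mem hAmem)) _
      · rintro _ ⟨n, rfl⟩
        exact zpow_mem hBmem _
    · rw [Subgroup.closure_le]
      have hTmem := MonoidHom.mem_range.2 ⟨_, hl⟩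
      have hBmem := MonoidHom.mem_range.2 ⟨_, hr⟩
      rintro _ (rfl | rfl)
      · rw [SetLike.mem_coe, eq_inv_mul_of_mul_eq hTA]
        exact mul_mem (inv_mem hTmem) hBmem
      · exact hBmem
end

section
/- Let A be the companion matrix of f(x) = (x-1)³(x²+x+1) and B the companion matrix of g(x) = (x+1)³(x²−x+1), and set T = B·A⁻¹ in GL(5,ℚ). Then T² = I with T ≠ I, B has infinite order, and the hypergeometric group Γ(f,g) = ⟨A,B⟩ is the free product of the subgroup generated by T and the subgroup generated by B: the canonical group homomorphism from the abstract free product (ℤ/2ℤ) ∗ ℤ to GL(5,ℚ) sending the generator of ℤ/2ℤ to T and the generator of ℤ to B is injective with image Γ(f,g). -/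
open Polynomial Matrix

/-- The elements `t * b ^ m₁ * t * b ^ m₂ * ⋯ * t * b ^ mₖ` with `1 ≤ k` and `m₁, …, mₖ₋₁ ≠ 0`. -/
inductive IsReducedWord {G : Type*} [Group G] (t b : G) : G → Prop
  | base (m : ℤ) : IsReducedWord t b (t * b ^ m)
  | step (n : ℤ) (g : G) : n ≠ 0 → IsReducedWord t b g → IsReducedWord t b (t * b ^ n * g)

namespace IsReducedWord

variable {G H : Type*} [Group G] [Group H] {t b g : G}

lemma map (φ : G →* H) (h : IsReducedWord t b g) : IsReducedWord (φ t) (φ b) (φ g) := by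
  induction h with
  | base m => simpa using IsReducedWord.base (t := φ t) (b := φ b) m
  | step n g hn _ ih => simpa using IsReducedWord.step n (φ g) hn ih

lemma mem_of_step {K : Set G} (hbase : ∀ m : ℤ, t * b ^ m ∈ K)
    (hstep : ∀ n : ℤ, n ≠ 0 → ∀ g ∈ K, t * b ^ n * g ∈ K) (h : IsReducedWord t b g) :
    g ∈ K := by
  induction h with
  | base m => exact hbase m
  | step n g hn _ ih => exact hstep n hn g ih

lemma zpow_mul_mul (ht : t * t = 1) (m : ℤ) (h : IsReducedWord t b g) :
    (∃ n : ℤ, t * (b ^ m * g) = b ^ n) ∨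
      ∃ (n : ℤ) (s : G), IsReducedWord t b s ∧ t * (b ^ m * g) = b ^ n * s := by
  by_cases hm : m = 0
  · subst hm
    cases h with
    | base n => exact Or.inl ⟨n, by simp [← mul_assoc, ht]⟩
    | step n s _ hs => exact Or.inr ⟨n, s, hs, by simp [← mul_assoc, ht]⟩
  · exact Or.inr ⟨0, _, .step m g hm h, by simp [mul_assoc]⟩

end IsReducedWord

section FreeProduct

open Monoid.Coprod Multiplicative

lemma Multiplicative.zmod_two_eq_one_or (z : Multiplicative (ZMod 2)) :
    z = 1 ∨ z = ofAdd (1 : ZMod 2) := by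
  revert z
  decide

lemma Multiplicative.eq_ofAdd_one_zpow (n : Multiplicative ℤ) : n = ofAdd (1 : ℤ) ^ toAdd n := by
  rw [← ofAdd_zsmul]
  simp

lemma Monoid.Coprod.eq_zpow_or_zpow_mul_isReducedWord
    (g : Monoid.Coprod (Multiplicative (ZMod 2)) (Multiplicative ℤ)) :
    (∃ m : ℤ, g = inr (ofAdd (1 : ℤ)) ^ m) ∨
      ∃ (m : ℤ) (s : _), IsReducedWord (inl (ofAdd (1 : ZMod 2))) (inr (ofAdd (1 : ℤ))) s ∧
        g = inr (ofAdd (1 : ℤ)) ^ m * s := by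
  have ht : (inl (ofAdd (1 : ZMod 2)) : Monoid.Coprod _ (Multiplicative ℤ)) *
      inl (ofAdd (1 : ZMod 2)) = 1 := by
    rw [← map_mul, show ofAdd (1 : ZMod 2) * ofAdd (1 : ZMod 2) = 1 by decide, map_one]
  induction g using Monoid.Coprod.induction_on' with
  | one => exact Or.inl ⟨0, by simp⟩
  | inl_mul z g ih =>
    rcases zmod_two_eq_one_or z with rfl | rfl
    · simpa using ih
    · rcases ih with ⟨m, rfl⟩ | ⟨m, s, hs, rfl⟩
      · exact Or.inr ⟨0, _, .base m, by simp⟩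
      · exact hs.zpow_mul_mul ht m
  | inr_mul n g ih =>
    rw [eq_ofAdd_one_zpow n, map_zpow]
    rcases ih with ⟨m, rfl⟩ | ⟨m, s, hs, rfl⟩
    · exact Or.inl ⟨toAdd n + m, by rw [_root_.zpow_add]⟩
    · exact Or.inr ⟨toAdd n + m, s, hs, by rw [_root_.zpow_add, mul_assoc]⟩

variable {G : Type*} [Group G] {t b : G}

/-- A one-sided ping-pong criterion for `⟨t, b⟩` to be the free product of `⟨t⟩ ≃ ℤ/2ℤ`
and `⟨b⟩ ≃ ℤ`. -/
lemma Monoid.Coprod.injective_of_table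
    (φ : Monoid.Coprod (Multiplicative (ZMod 2)) (Multiplicative ℤ) →* G)
    (hφt : φ (inl (ofAdd (1 : ZMod 2))) = t) (hφb : φ (inr (ofAdd (1 : ℤ))) = b)
    {K : Set G} (hb : ∀ m : ℤ, m ≠ 0 → b ^ m ≠ 1) (hbK : ∀ m : ℤ, b ^ m ∉ K)
    (hbase : ∀ m : ℤ, t * b ^ m ∈ K)
    (hstep : ∀ n : ℤ, n ≠ 0 → ∀ g ∈ K, t * b ^ n * g ∈ K) :
    Function.Injective φ := by
  rw [injective_iff_map_eq_one]
  intro g hg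
  rcases eq_zpow_or_zpow_mul_isReducedWord g with ⟨m, rfl⟩ | ⟨m, s, hs, rfl⟩
  · rw [map_zpow, hφb] at hg
    by_cases hm : m = 0
    · simp [hm]
    · exact absurd hg (hb m hm)
  · have hsK := (hs.map φ).mem_of_step (K := K) (by rwa [hφt, hφb]) (by rwa [hφt, hφb])
    rw [map_mul, map_zpow, hφb, mul_eq_one_iff_inv_eq, ← _root_.zpow_neg] at hg
    exact absurd (hg ▸ hsK) (hbK (-m))

/-- An element `t` with `t ^ 2 = 1` and an arbitrary element `b` define a homomorphism from
`ℤ/2ℤ ∗ ℤ`, whose range is generated by `t` and `b`. -/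
lemma Monoid.Coprod.exists_hom_of_sq_eq_one (ht : t ^ 2 = 1) (b : G) :
    ∃ φ : Monoid.Coprod (Multiplicative (ZMod 2)) (Multiplicative ℤ) →* G,
      φ (inl (ofAdd (1 : ZMod 2))) = t ∧ φ (inr (ofAdd (1 : ℤ))) = b ∧
        φ.range = Subgroup.closure {t, b} := by
  have hz : zmultiplesHom (Additive G) (Additive.ofMul t) (2 : ℕ) = 0 := by
    rw [zmultiplesHom_apply, natCast_zsmul, ← ofMul_pow, ht, ofMul_one]
  let τ : ZMod 2 →+ Additive G :=
    ZMod.lift 2 ⟨zmultiplesHom (Additive G) (Additive.ofMul t), hz⟩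
  have hτ : τ 1 = Additive.ofMul t := by
    have h := ZMod.lift_coe 2 ⟨zmultiplesHom (Additive G) (Additive.ofMul t), hz⟩ 1
    rw [Int.cast_one] at h
    simpa using h
  refine ⟨lift (AddMonoidHom.toMultiplicativeLeft τ) (zpowersHom G b), ?_, ?_, ?_⟩
  · simp [hτ]
  · simp
  · rw [range_lift]
    apply le_antisymm
    · refine sup_le ?_ ?_
      · rintro _ ⟨z, rfl⟩
        rcases zmod_two_eq_one_or z with rfl | rfl
        · simp
        · simpa [hτ] using Subgroup.subset_closure (by simp)
      · rintro _ ⟨n, rfl⟩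
        simpa using Subgroup.zpow_mem _ (Subgroup.subset_closure (by simp)) _
    · rw [Subgroup.closure_le]
      rintro x (rfl | rfl)
      · exact Subgroup.mem_sup_left ⟨ofAdd 1, by simp [hτ]⟩
      · exact Subgroup.mem_sup_right ⟨ofAdd 1, by simp⟩

end FreeProduct

/-- The companion matrix of `(X + 1) ^ 3 * (X ^ 2 - X + 1)`. -/
def rotationMatrix : Matrix (Fin 5) (Fin 5) ℚ :=
  !![0, 0, 0, 0, -1; 1, 0, 0, 0, -2; 0, 1, 0, 0, -1; 0, 0, 1, 0, -1; 0, 0, 0, 1, -2]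

/-- The matrix of the reflection `T`. -/
def reflectionMatrix : Matrix (Fin 5) (Fin 5) ℚ :=
  !![-1, 0, 0, 0, 0; 0, 1, 0, 0, 0; -2, 0, 1, 0, 0; 0, 0, 0, 1, 0; -4, 0, 0, 0, 1]

/-- An involution that commutes with `reflectionMatrix` and inverts `rotationMatrix`. -/
def flipMatrix : Matrix (Fin 5) (Fin 5) ℚ :=
  !![1, 0, 0, 0, 0; 2, 0, 0, 0, -1; 1, 0, 0, -1, 0; 1, 0, -1, 0, 0; 2, -1, 0, 0, 0]

/-- The fixed line of `rotationMatrix`. -/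
def cuspVector : Fin 5 → ℚ := ![1, 1, 0, 1, 1]

/-- A polyhedral cone containing, up to sign, the images of `cuspVector` under the reduced words
that start with `T`. -/
def InTableCone (x : Fin 5 → ℚ) : Prop :=
  0 ≤ -19 * x 0 + 9 * x 1 + x 2 - 11 * x 3 + 21 * x 4 ∧
  0 ≤ -5 * x 0 - 3 * x 1 - x 2 + x 3 + 3 * x 4 ∧
  0 ≤ 31 * x 0 - 21 * x 1 + 11 * x 2 - x 3 - 9 * x 4 ∧
  0 ≤ x 0 + x 1 + x 2 + x 3 + x 4 ∧
  0 ≤ 7 * x 0 - x 1 - x 2 - x 3 - x 4 ∧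
  0 ≤ 55 * x 0 - 17 * x 1 - 21 * x 2 + 11 * x 3 - x 4 ∧
  0 ≤ 9 * x 0 + x 1 - 11 * x 2 + 21 * x 3 + 17 * x 4 ∧
  0 ≤ 35 * x 0 - 9 * x 1 - 17 * x 2 - 21 * x 3 + 11 * x 4 ∧
  0 ≤ x 0 - 11 * x 1 + 21 * x 2 + 17 * x 3 + 9 * x 4 ∧
  0 ≤ 55 * x 0 - 13 * x 1 + 35 * x 2 - 9 * x 3 - 17 * x 4 ∧
  0 ≤ 21 * x 0 + 17 * x 1 + 9 * x 2 - 35 * x 3 + 13 * x 4 ∧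
  0 ≤ 127 * x 0 - 57 * x 1 - 13 * x 2 + 35 * x 3 - 9 * x 4 ∧
  0 ≤ 17 * x 0 + 9 * x 1 - 35 * x 2 + 13 * x 3 + 57 * x 4

/-- A polyhedral cone containing, up to sign, the translates of `InTableCone` by positive powers
of `rotationMatrix`. -/
def InShiftedCone (x : Fin 5 → ℚ) : Prop :=
  0 ≤ 67 * x 0 - 9 * x 1 - x 2 + 11 * x 3 - 21 * x 4 ∧
  0 ≤ 5 * x 0 + 3 * x 1 + x 2 - x 3 - 3 * x 4 ∧
  0 ≤ 7 * x 0 - x 1 - x 2 - x 3 - x 4 ∧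
  0 ≤ 9 * x 0 + 17 * x 1 + 21 * x 2 - 11 * x 3 + x 4 ∧
  0 ≤ 55 * x 0 - x 1 + 11 * x 2 - 21 * x 3 - 17 * x 4 ∧
  0 ≤ 45 * x 0 + 9 * x 1 + 17 * x 2 + 21 * x 3 - 11 * x 4 ∧
  0 ≤ 91 * x 0 - 17 * x 1 - 9 * x 2 + 35 * x 3 - 13 * x 4 ∧
  0 ≤ 175 * x 0 - 9 * x 1 + 35 * x 2 - 13 * x 3 - 57 * x 4 ∧
  0 ≤ -29 * x 0 + 19 * x 1 - 9 * x 2 - x 3 + 11 * x 4 ∧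
  0 ≤ x 0 - x 1 + x 2 - x 3 + x 4 ∧
  0 ≤ 9 * x 0 + x 1 - 11 * x 2 + 21 * x 3 + 17 * x 4 ∧
  0 ≤ -3 * x 0 - x 1 + x 2 + 3 * x 3 + 5 * x 4 ∧
  0 ≤ -17 * x 0 - 21 * x 1 + 11 * x 2 - x 3 + 55 * x 4 ∧
  0 ≤ x 0 - 11 * x 1 + 21 * x 2 + 17 * x 3 + 9 * x 4 ∧
  0 ≤ 9 * x 0 - 35 * x 1 + 13 * x 2 + 57 * x 3 + 65 * x 4 ∧
  0 ≤ 21 * x 0 - 11 * x 1 + x 2 - 55 * x 3 + 61 * x 4 ∧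
  0 ≤ 11 * x 0 - 21 * x 1 - 17 * x 2 - 9 * x 3 + 35 * x 4

/-- The vectors lying in `InTableCone` up to sign. -/
def tableSet : Set (Fin 5 → ℚ) := {x | InTableCone x ∨ InTableCone (-x)}

/-- The vectors lying in `InShiftedCone` up to sign. -/
def shiftedSet : Set (Fin 5 → ℚ) := {x | InShiftedCone x ∨ InShiftedCone (-x)}

lemma inShiftedCone_of_inTableCone {x : Fin 5 → ℚ} (h : InTableCone x) :
    InShiftedCone (-(rotationMatrix *ᵥ x)) := by
  simp only [InTableCone, InShiftedCone, rotationMatrix, Matrix.mulVec, dotProduct,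
    Fin.sum_univ_five, Pi.neg_apply, Matrix.of_apply, Matrix.cons_val] at h ⊢
  obtain ⟨h1, h2, h3, h4, h5, h6, h7, h8, h9, h10, h11, h12, h13⟩ := h
  refine ⟨?_, ?_, ?_, ?_, ?_, ?_, ?_, ?_, ?_, ?_, ?_, ?_, ?_, ?_, ?_, ?_, ?_⟩ <;> linarith

lemma inShiftedCone_rotationMatrix {x : Fin 5 → ℚ} (h : InShiftedCone x) :
    InShiftedCone (-(rotationMatrix *ᵥ x)) := by
  simp only [InShiftedCone, rotationMatrix, Matrix.mulVec, dotProduct,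
    Fin.sum_univ_five, Pi.neg_apply, Matrix.of_apply, Matrix.cons_val] at h ⊢
  obtain ⟨h1, h2, h3, h4, h5, h6, h7, h8, h9, h10, h11, h12, h13, h14, h15, h16, h17⟩ := h
  refine ⟨?_, ?_, ?_, ?_, ?_, ?_, ?_, ?_, ?_, ?_, ?_, ?_, ?_, ?_, ?_, ?_, ?_⟩ <;> linarith

lemma inTableCone_reflectionMatrix {x : Fin 5 → ℚ} (h : InShiftedCone x) :
    InTableCone (-(reflectionMatrix *ᵥ x)) := by
  simp only [InTableCone, InShiftedCone, reflectionMatrix, Matrix.mulVec, dotProduct,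
    Fin.sum_univ_five, Pi.neg_apply, Matrix.of_apply, Matrix.cons_val] at h ⊢
  obtain ⟨h1, h2, h3, h4, h5, h6, h7, h8, h9, h10, h11, h12, h13, h14, h15, h16, h17⟩ := h
  refine ⟨?_, ?_, ?_, ?_, ?_, ?_, ?_, ?_, ?_, ?_, ?_, ?_, ?_⟩ <;> linarith

lemma inTableCone_flipMatrix {x : Fin 5 → ℚ} (h : InTableCone x) :
    InTableCone (flipMatrix *ᵥ x) := by
  simp only [InTableCone, flipMatrix, Matrix.mulVec, dotProduct,
    Fin.sum_univ_five, Matrix.of_apply, Matrix.cons_val] at h ⊢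
  obtain ⟨h1, h2, h3, h4, h5, h6, h7, h8, h9, h10, h11, h12, h13⟩ := h
  refine ⟨?_, ?_, ?_, ?_, ?_, ?_, ?_, ?_, ?_, ?_, ?_, ?_, ?_⟩ <;> linarith

lemma neg_mem_tableSet {x : Fin 5 → ℚ} (h : x ∈ tableSet) : -x ∈ tableSet := by
  rcases h with h | h
  · exact Or.inr (by rwa [neg_neg])
  · exact Or.inl h

lemma rotationMatrix_mem_shiftedSet {x : Fin 5 → ℚ} (h : x ∈ tableSet ∨ x ∈ shiftedSet) :
    rotationMatrix *ᵥ x ∈ shiftedSet := by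
  rcases h with (h | h) | (h | h)
  · exact Or.inr (inShiftedCone_of_inTableCone h)
  · exact Or.inl (by simpa [Matrix.mulVec_neg] using inShiftedCone_of_inTableCone h)
  · exact Or.inr (inShiftedCone_rotationMatrix h)
  · exact Or.inl (by simpa [Matrix.mulVec_neg] using inShiftedCone_rotationMatrix h)

lemma reflectionMatrix_mem_tableSet {x : Fin 5 → ℚ} (h : x ∈ shiftedSet) :
    reflectionMatrix *ᵥ x ∈ tableSet := by
  rcases h with h | h
  · exact Or.inr (inTableCone_reflectionMatrix h)
  · exact Or.inl (by simpa [Matrix.mulVec_neg] using inTableCone_reflectionMatrix h)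

lemma flipMatrix_mem_tableSet {x : Fin 5 → ℚ} (h : x ∈ tableSet) :
    flipMatrix *ᵥ x ∈ tableSet := by
  rcases h with h | h
  · exact Or.inl (inTableCone_flipMatrix h)
  · exact Or.inr (by simpa [Matrix.mulVec_neg] using inTableCone_flipMatrix h)

lemma cuspVector_notMem_tableSet : cuspVector ∉ tableSet := by
  rintro (h | h)
  · have := h.2.1
    simp only [cuspVector, Matrix.cons_val] at this
    norm_num at this
  · have := h.2.2.2.1
    simp only [cuspVector, Pi.neg_apply, Matrix.cons_val] at this
    norm_num at this

lemma reflectionMatrix_cuspVector_mem_tableSet :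
    reflectionMatrix *ᵥ cuspVector ∈ tableSet := by
  right
  simp only [InTableCone, reflectionMatrix, cuspVector, Matrix.mulVec, dotProduct,
    Fin.sum_univ_five, Pi.neg_apply, Matrix.of_apply, Matrix.cons_val]
  norm_num

lemma rotationMatrix_mulVec_cuspVector : rotationMatrix *ᵥ cuspVector = -cuspVector := by
  decide +kernel

lemma reflectionMatrix_mul_self : reflectionMatrix * reflectionMatrix = 1 := by
  decide +kernel

lemma flipMatrix_mul_self : flipMatrix * flipMatrix = 1 := by
  decide +kernel

lemma flipMatrix_mul_reflectionMatrix :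
    flipMatrix * reflectionMatrix = reflectionMatrix * flipMatrix := by
  decide +kernel

lemma rotationMatrix_mul_flipMatrix_mul_rotationMatrix :
    rotationMatrix * flipMatrix * rotationMatrix = flipMatrix := by
  decide +kernel

lemma rotationMatrix_pow_mul_flipMatrix_mul_pow (n : ℕ) :
    rotationMatrix ^ n * flipMatrix * rotationMatrix ^ n = flipMatrix := by
  induction n with
  | zero => simp
  | succ n ih =>
    calc rotationMatrix ^ (n + 1) * flipMatrix * rotationMatrix ^ (n + 1)
        = rotationMatrix ^ n * (rotationMatrix * flipMatrix * rotationMatrix) *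
            rotationMatrix ^ n := by
          nth_rw 2 [pow_succ']
          simp only [pow_succ, mul_assoc]
      _ = flipMatrix := by rw [rotationMatrix_mul_flipMatrix_mul_rotationMatrix, ih]

lemma rotationMatrix_pow_mem_shiftedSet {x : Fin 5 → ℚ} (h : x ∈ tableSet) (n : ℕ) :
    rotationMatrix ^ (n + 1) *ᵥ x ∈ shiftedSet := by
  induction n with
  | zero => simpa using rotationMatrix_mem_shiftedSet (Or.inl h)
  | succ n ih =>
    rw [pow_succ', ← Matrix.mulVec_mulVec]
    exact rotationMatrix_mem_shiftedSet (Or.inr ih)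

/-- Conjugating by `flipMatrix` turns negative powers of `rotationMatrix` into positive ones. -/
lemma reflectionMatrix_mem_tableSet_of_pow_mem {y : Fin 5 → ℚ} {n : ℕ}
    (h : rotationMatrix ^ (n + 1) *ᵥ y ∈ tableSet) : reflectionMatrix *ᵥ y ∈ tableSet := by
  have h1 := reflectionMatrix_mem_tableSet
    (rotationMatrix_pow_mem_shiftedSet (flipMatrix_mem_tableSet h) n)
  simp only [Matrix.mulVec_mulVec] at h1
  rw [← mul_assoc (rotationMatrix ^ (n + 1)), rotationMatrix_pow_mul_flipMatrix_mul_pow,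
    ← flipMatrix_mul_reflectionMatrix] at h1
  simpa [Matrix.mulVec_mulVec, ← mul_assoc, flipMatrix_mul_self] using flipMatrix_mem_tableSet h1

section GeneralLinear

variable {T B : GL (Fin 5) ℚ}

lemma zpow_mulVec_cuspVector (hB : (B : Matrix (Fin 5) (Fin 5) ℚ) = rotationMatrix) (m : ℤ) :
    (↑(B ^ m) : Matrix (Fin 5) (Fin 5) ℚ) *ᵥ cuspVector = cuspVector ∨
      (↑(B ^ m) : Matrix (Fin 5) (Fin 5) ℚ) *ᵥ cuspVector = -cuspVector := by
  have hBc : (B : Matrix (Fin 5) (Fin 5) ℚ) *ᵥ cuspVector = -cuspVector := by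
    rw [hB, rotationMatrix_mulVec_cuspVector]
  have hBc' : (↑(B⁻¹) : Matrix (Fin 5) (Fin 5) ℚ) *ᵥ cuspVector = -cuspVector := by
    rw [← neg_eq_iff_eq_neg, ← Matrix.mulVec_neg, ← hBc, Matrix.mulVec_mulVec, ← Units.val_mul]
    simp
  induction m using Int.induction_on with
  | zero => simp
  | succ n ih =>
    rw [_root_.zpow_add_one, Units.val_mul, ← Matrix.mulVec_mulVec, hBc, Matrix.mulVec_neg, neg_inj,
      neg_eq_iff_eq_neg]
    exact ih.symm
  | pred n ih =>
    rw [_root_.zpow_sub_one, Units.val_mul, ← Matrix.mulVec_mulVec, hBc', Matrix.mulVec_neg, neg_inj,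
      neg_eq_iff_eq_neg]
    exact ih.symm

lemma mul_zpow_mulVec_mem_tableSet (hT : (T : Matrix (Fin 5) (Fin 5) ℚ) = reflectionMatrix)
    (hB : (B : Matrix (Fin 5) (Fin 5) ℚ) = rotationMatrix) {n : ℤ} (hn : n ≠ 0)
    {x : Fin 5 → ℚ} (h : x ∈ tableSet) :
    (↑(T * B ^ n) : Matrix (Fin 5) (Fin 5) ℚ) *ᵥ x ∈ tableSet := by
  rw [Units.val_mul, ← Matrix.mulVec_mulVec, hT]
  obtain ⟨k, rfl | rfl⟩ : ∃ k : ℕ, n = (k + 1 : ℕ) ∨ n = -(k + 1 : ℕ) :=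
    ⟨n.natAbs - 1, by omega⟩
  · rw [_root_.zpow_natCast, Units.val_pow_eq_pow_val, hB]
    exact reflectionMatrix_mem_tableSet (rotationMatrix_pow_mem_shiftedSet h k)
  · apply reflectionMatrix_mem_tableSet_of_pow_mem (n := k)
    rw [← hB, ← Units.val_pow_eq_pow_val, Matrix.mulVec_mulVec, ← Units.val_mul, _root_.zpow_neg,
      _root_.zpow_natCast, mul_inv_cancel]
    simpa using h

end GeneralLinear

lemma companionMatrix_eq_rotationMatrix :
    companionMatrix ((X + 1) ^ 3 * (X ^ 2 - X + 1)) = rotationMatrix := by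
  have h : ((X + 1) ^ 3 * (X ^ 2 - X + 1) : ℚ[X]) =
      X ^ 5 + C 2 * X ^ 4 + X ^ 3 + X ^ 2 + C 2 * X + C 1 := by
    simp only [map_ofNat, map_one]
    ring
  ext i j
  fin_cases i <;> fin_cases j <;>
    simp [companionMatrix, rotationMatrix, h, coeff_X, coeff_one, coeff_X_pow]

lemma reflectionMatrix_mul_companionMatrix :
    reflectionMatrix * companionMatrix ((X - 1) ^ 3 * (X ^ 2 + X + 1)) = rotationMatrix := by
  have h : ((X - 1) ^ 3 * (X ^ 2 + X + 1) : ℚ[X]) =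
      X ^ 5 - C 2 * X ^ 4 + X ^ 3 - X ^ 2 + C 2 * X - C 1 := by
    simp only [map_ofNat, map_one]
    ring
  have hA : companionMatrix ((X - 1) ^ 3 * (X ^ 2 + X + 1)) =
      !![0, 0, 0, 0, 1; 1, 0, 0, 0, -2; 0, 1, 0, 0, 1; 0, 0, 1, 0, -1; 0, 0, 0, 1, 2] := by
    ext i j
    fin_cases i <;> fin_cases j <;>
      simp [companionMatrix, h, coeff_X, coeff_one, coeff_X_pow]
  rw [hA]
  decide +kernel

/-- `Γ(f,g) = ⟨T⟩ ∗ ⟨B⟩` for `f = ((X - 1) ^ 3 * (X ^ 2 + X + 1))`, `g = ((X + 1) ^ 3 * (X ^ 2 - X + 1))`. -/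
theorem hypergeometric_free_product_case13 (A B T : GL (Fin 5) ℚ)
    (hA : (↑A : Matrix (Fin 5) (Fin 5) ℚ) = companionMatrix ((X - 1) ^ 3 * (X ^ 2 + X + 1)))
    (hB : (↑B : Matrix (Fin 5) (Fin 5) ℚ) = companionMatrix ((X + 1) ^ 3 * (X ^ 2 - X + 1)))
    (hT : T = B * A⁻¹) :
    T ^ 2 = 1 ∧ T ≠ 1 ∧ ¬ IsOfFinOrder B ∧
    ∃ φ : Monoid.Coprod (Multiplicative (ZMod 2)) (Multiplicative ℤ) →* GL (Fin 5) ℚ,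
      φ (Monoid.Coprod.inl (Multiplicative.ofAdd (1 : ZMod 2))) = T ∧
      φ (Monoid.Coprod.inr (Multiplicative.ofAdd (1 : ℤ))) = B ∧
      Function.Injective φ ∧
      φ.range = Subgroup.closure {A, B} := by
  rw [companionMatrix_eq_rotationMatrix] at hB
  have hTA : T * A = B := by rw [hT, inv_mul_cancel_right]
  have hTM : (T : Matrix (Fin 5) (Fin 5) ℚ) = reflectionMatrix := by
    rw [hT, Units.val_mul, hB, ← reflectionMatrix_mul_companionMatrix, ← hA, mul_assoc,
      ← Units.val_mul]
    simp
  have hT2 : T ^ 2 = 1 := by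
    ext1
    rw [pow_two, Units.val_mul, hTM, reflectionMatrix_mul_self, Units.val_one]
  let K : Set (GL (Fin 5) ℚ) :=
    {g | (g : Matrix (Fin 5) (Fin 5) ℚ) *ᵥ cuspVector ∈ tableSet}
  have hbK : ∀ m : ℤ, B ^ m ∉ K := by
    intro m hm
    change _ *ᵥ _ ∈ tableSet at hm
    rcases zpow_mulVec_cuspVector hB m with h | h <;> rw [h] at hm
    · exact cuspVector_notMem_tableSet hm
    · exact cuspVector_notMem_tableSet (neg_neg cuspVector ▸ neg_mem_tableSet hm)
  have hbase : ∀ m : ℤ, T * B ^ m ∈ K := by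
    intro m
    change _ *ᵥ _ ∈ tableSet
    rw [Units.val_mul, ← Matrix.mulVec_mulVec, hTM]
    rcases zpow_mulVec_cuspVector hB m with h | h <;> rw [h]
    · exact reflectionMatrix_cuspVector_mem_tableSet
    · rw [Matrix.mulVec_neg]
      exact neg_mem_tableSet reflectionMatrix_cuspVector_mem_tableSet
  have hstep : ∀ n : ℤ, n ≠ 0 → ∀ g ∈ K, T * B ^ n * g ∈ K := by
    intro n hn g hg
    change _ *ᵥ _ ∈ tableSet
    rw [Units.val_mul, ← Matrix.mulVec_mulVec]
    exact mul_zpow_mulVec_mem_tableSet hTM hB hn hg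
  have hTK : T ∈ K := by simpa using hbase 0
  have hone : (1 : GL (Fin 5) ℚ) ∉ K := by simpa using hbK 0
  have hord : ∀ m : ℤ, m ≠ 0 → B ^ m ≠ 1 := by
    intro m hm h
    have := hstep m hm T hTK
    rw [h, mul_one, ← pow_two, hT2] at this
    exact hone this
  obtain ⟨φ, hφT, hφB, hφ⟩ := Monoid.Coprod.exists_hom_of_sq_eq_one hT2 B
  refine ⟨hT2, fun h => hone (h ▸ hTK), ?_, φ, hφT, hφB,
    Monoid.Coprod.injective_of_table φ hφT hφB hord hbK hbase hstep, ?_⟩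
  · rw [isOfFinOrder_iff_pow_eq_one]
    rintro ⟨n, hn, h⟩
    exact hord n (by omega) (by simpa using h)
  · rw [hφ]
    apply le_antisymm <;> rw [Subgroup.closure_le]
    · have hAB : A ∈ Subgroup.closure {A, B} ∧ B ∈ Subgroup.closure {A, B} :=
        ⟨Subgroup.subset_closure (by simp), Subgroup.subset_closure (by simp)⟩
      rintro x (rfl | rfl)
      · exact hT ▸ mul_mem hAB.2 (inv_mem hAB.1)
      · exact hAB.2
    · have hTB : T ∈ Subgroup.closure {T, B} ∧ B ∈ Subgroup.closure {T, B} :=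
        ⟨Subgroup.subset_closure (by simp), Subgroup.subset_closure (by simp)⟩
      rintro x (rfl | rfl)
      · have hA' : x = T⁻¹ * B := by rw [← hTA, inv_mul_cancel_left]
        exact hA' ▸ mul_mem (inv_mem hTB.1) hTB.2
      · exact hTB.2
end
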